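/- Let G be an α_1-metric graph and v a vertex with e(v) = rad(G)+2. Then v has a neighbor w with e(w) < e(v) (i.e., the locality of v equals 1). -/

import Mathlib

open SimpleGraph

variable {V : Type*}

/-- `Itv G u v x` means `x` lies on a shortest `(u,v)`-path, i.e. `x ∈ I(u,v)`. -/
def Itv (G : SimpleGraph V) (u v x : V) : Prop :=
  G.dist u x + G.dist x v = G.dist u v

/-- `G` is an `α_i`-metric graph. -/
def AlphaI (G : SimpleGraph V) (i : ℕ) : Prop :=
  ∀ u v w x : V, Itv G u w v → Itv G v x w → G.Adj v w →
    G.dist u v + G.dist v x ≤ G.dist u x + i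

/-- Eccentricity of a vertex. -/
noncomputable def ecc (G : SimpleGraph V) [Fintype V] (v : V) : ℕ :=
  Finset.univ.sup (fun u => G.dist v u)

/-- Radius of the graph. -/
noncomputable def grad (G : SimpleGraph V) [Fintype V] [Nonempty V] : ℕ :=
  Finset.univ.inf' Finset.univ_nonempty (fun v => ecc G v)

/-- Diameter of the graph. -/
noncomputable def gdiam (G : SimpleGraph V) [Fintype V] : ℕ :=
  Finset.univ.sup (fun v => ecc G v)

namespace SimpleGraph

variable {G : SimpleGraph V}

lemma Connected.dist_le_succ_of_adj (hG : G.Connected) {x y : V} (h : G.Adj x y) (z : V) :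
    G.dist x z ≤ G.dist y z + 1 := by
  have h₁ := hG.dist_triangle (u := x) (v := y) (w := z)
  rw [dist_eq_one_iff_adj.2 h] at h₁
  omega

lemma Connected.exists_adj_dist_eq (hG : G.Connected) {x y : V} {n : ℕ}
    (h : G.dist x y = n + 1) : ∃ z, G.Adj x z ∧ G.dist z y = n := by
  obtain ⟨p, hp⟩ := hG.exists_walk_length_eq_dist x y
  cases p with
  | nil => simp at h
  | @cons _ z _ hxz q =>
    refine ⟨z, hxz, ?_⟩
    have hq := dist_le q
    have hz := hG.dist_le_succ_of_adj hxz y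
    rw [Walk.length_cons] at hp
    omega

lemma Connected.eq_or_adj_of_dist_le_one (hG : G.Connected) {x y : V} (h : G.dist x y ≤ 1) :
    x = y ∨ G.Adj x y := by
  rcases Nat.le_one_iff_eq_zero_or_eq_one.1 h with h | h
  · exact .inl (hG.dist_eq_zero_iff.1 h)
  · exact .inr (dist_eq_one_iff_adj.1 h)

end SimpleGraph

namespace AlphaI

variable {G : SimpleGraph V}

/-- Disks of an `α₁`-metric graph are convex. -/
lemma dist_le_of_itv (hα : AlphaI G 1) (hG : G.Connected) {f x y z : V} {k : ℕ}
    (hx : G.dist x f ≤ k) (hy : G.dist y f ≤ k) (hz : Itv G x y z) : G.dist z f ≤ k := by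
  by_contra! hk
  suffices key : ∀ n z, G.dist z y = n → Itv G x y z → z ≠ x → G.dist y f < G.dist z f →
      G.dist z f ≤ G.dist x f by
    have := key _ z rfl hz (by rintro rfl; omega) (by omega)
    omega
  intro n
  induction n with
  | zero =>
    intro z h _ _ hlt
    rw [hG.dist_eq_zero_iff.1 h] at hlt
    omega
  | succ n ih =>
    intro z h hz hzx hlt
    obtain ⟨z', hadj, hz'⟩ := hG.exists_adj_dist_eq h
    unfold Itv at hz
    have hpos := hG.pos_dist_of_ne hzx.symm
    have h₁ := hG.dist_le_succ_of_adj hadj.symm x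
    have h₂ := hG.dist_triangle (u := x) (v := z') (w := y)
    have h₃ := hG.dist_le_succ_of_adj hadj f
    rw [dist_comm (u := z') (v := x), dist_comm (u := z) (v := x)] at h₁
    by_cases hd : G.dist z' f < G.dist z f
    · have hzz' := dist_eq_one_iff_adj.2 hadj
      have := hα x z z' f (by unfold Itv; omega) (by unfold Itv; omega) hadj
      omega
    · have := ih z' hz' (by unfold Itv; omega) (by rintro rfl; simp at *; omega) (by omega)
      omega

/-- The neighbours of `x` lying one step closer to `y` form a clique. -/
lemma eq_or_adj_of_dist_eq (hα : AlphaI G 1) (hG : G.Connected) {x y a b : V} {n : ℕ}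
    (hxy : G.dist x y = n + 1) (hxa : G.Adj x a) (hxb : G.Adj x b)
    (ha : G.dist a y = n) (hb : G.dist b y = n) : a = b ∨ G.Adj a b := by
  apply hG.eq_or_adj_of_dist_le_one
  by_contra! h
  have h₁ := hG.dist_le_succ_of_adj hxa.symm b
  have hxb' := dist_eq_one_iff_adj.2 hxb
  have hax := dist_eq_one_iff_adj.2 hxa.symm
  have := hα.dist_le_of_itv hG ha.le hb.le (z := x) (by unfold Itv; omega)
  omega

/-- The triangle-pentagon condition. -/
lemma triangle_or_pentagon (hα : AlphaI G 1) (hG : G.Connected) {x y f : V} {k : ℕ}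
    (hxy : G.Adj x y) (hx : G.dist x f = k + 2) (hy : G.dist y f = k + 2) :
    (∃ t, G.Adj x t ∧ G.Adj y t ∧ G.dist t f = k + 1) ∨
    ∃ a b z, G.Adj x b ∧ G.Adj y a ∧ G.Adj b z ∧ G.Adj a z ∧
      G.dist a f = k + 1 ∧ G.dist b f = k + 1 ∧ G.dist z f = k := by
  obtain ⟨a, hya, ha⟩ := hG.exists_adj_dist_eq hy
  obtain ⟨b, hxb, hb⟩ := hG.exists_adj_dist_eq hx
  obtain ⟨z, hbz, hz⟩ := hG.exists_adj_dist_eq hb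
  have hyx' := dist_eq_one_iff_adj.2 hxy.symm
  have hbz' := dist_eq_one_iff_adj.2 hbz
  have hax := hG.dist_le_succ_of_adj hya.symm x
  have hyb := hG.dist_le_succ_of_adj hxy.symm b
  have hxb' := dist_eq_one_iff_adj.2 hxb
  have hab := hG.dist_le_succ_of_adj hya.symm b
  have hab₂ : G.dist a b ≤ 2 := by
    by_contra! h
    have h₃ := hG.dist_triangle (u := a) (v := x) (w := b)
    have := hα.dist_le_of_itv hG ha.le hb.le (z := x) (by unfold Itv; omega)
    omega
  have haz : G.dist a z ≤ 2 := by
    by_contra! h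
    have h₃ := hG.dist_triangle (u := a) (v := b) (w := z)
    have := hα a b z f (by unfold Itv; omega) (by unfold Itv; omega) hbz
    omega
  have hxz := hG.dist_le_succ_of_adj hxb z
  have hyz := hG.dist_le_succ_of_adj hxy.symm z
  have hyaz := hG.dist_le_succ_of_adj hya z
  have hyf := hG.dist_triangle (u := y) (v := z) (w := f)
  by_cases h : G.dist y z = 2
  · obtain ⟨a', hya', ha'⟩ := hG.exists_adj_dist_eq h
    have ha'z := dist_eq_one_iff_adj.1 ha'
    have h₁ := hG.dist_le_succ_of_adj hya' f
    have h₂ := hG.dist_le_succ_of_adj ha'z f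
    exact .inr ⟨a', b, z, hxb, hya', hbz, ha'z, by omega, hb, hz⟩
  · rcases hα.eq_or_adj_of_dist_eq hG (show G.dist y z = 2 + 1 by omega) hya hxy.symm
      (by omega) (by omega) with rfl | h
    · omega
    · exact .inl ⟨a, h.symm, hya, ha⟩

end AlphaI

lemma dist_le_ecc [Fintype V] (G : SimpleGraph V) (v u : V) : G.dist v u ≤ ecc G v :=
  Finset.le_sup (f := fun u => G.dist v u) (Finset.mem_univ u)

lemma exists_dist_eq_ecc [Fintype V] (G : SimpleGraph V) (v : V) : ∃ u, G.dist v u = ecc G v := by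
  obtain ⟨u, -, hu⟩ := Finset.exists_mem_eq_sup Finset.univ ⟨v, Finset.mem_univ v⟩
    (fun u => G.dist v u)
  exact ⟨u, hu.symm⟩

lemma ecc_le_of_dist [Fintype V] {G : SimpleGraph V} (hG : G.Connected) (x y : V) :
    ecc G x ≤ G.dist x y + ecc G y := by
  obtain ⟨u, hu⟩ := exists_dist_eq_ecc G x
  have h₁ := hG.dist_triangle (u := x) (v := y) (w := u)
  have h₂ := dist_le_ecc G y u
  omega

/-- If `v` has eccentricity `r + 2` while a vertex at distance three from `v` has eccentricity
at most `r`, then some neighbour of `v` has eccentricity less than `r + 2`. -/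
lemma AlphaI.exists_adj_ecc_lt [Fintype V] {G : SimpleGraph V} (hα : AlphaI G 1)
    (hG : G.Connected) {v c : V} {r : ℕ} (hv : ecc G v = r + 2) (hc : ecc G c ≤ r)
    (hvc : G.dist v c = 3) : ∃ w, G.Adj v w ∧ ecc G w < r + 2 := by
  classical
  by_contra! hno
  have hdc : ∀ x, G.dist c x ≤ r := fun x => (dist_le_ecc G c x).trans hc
  let N : Finset V := {w | G.Adj v w ∧ G.dist w c = 2}
  let F : V → Finset V := fun w => {x | G.dist w x = r + 2}
  obtain ⟨w₀, hw₀, hw₀c⟩ := hG.exists_adj_dist_eq hvc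
  obtain ⟨w, hwN, hmin⟩ := N.exists_min_image (fun w => (F w).card)
    ⟨w₀, by simp [N, hw₀, hw₀c]⟩
  obtain ⟨hvw, hwc⟩ : G.Adj v w ∧ G.dist w c = 2 := by simpa [N] using hwN
  have heccN : ∀ x, G.dist x c = 2 → ∀ y, G.dist x y ≤ r + 2 := fun x hx y => by
    have h₁ := hG.dist_triangle (u := x) (v := c) (w := y)
    have h₂ := hdc y
    omega
  obtain ⟨f, hf⟩ := exists_dist_eq_ecc G w
  have hwf : G.dist w f = r + 2 := by
    have h₁ := hno w hvw
    have h₂ := heccN w hwc f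
    omega
  -- a common neighbour of `v` and `w` closer to `f` contradicts the minimality of `F w`
  have noTriangle : ∀ t, G.Adj v t → G.Adj w t → G.dist t c ≤ 2 → G.dist t f ≤ r + 1 → False := by
    intro t hvt hwt htc htf
    have h₁ := hG.dist_le_succ_of_adj hvt c
    have htc' : G.dist t c = 2 := by omega
    have hcard := hmin t (by simp [N, hvt, htc'])
    obtain ⟨g, hgt, hgw⟩ : ∃ g ∈ F t, g ∉ F w := by
      by_contra! hsub
      have : F t ⊂ F w := (Finset.ssubset_iff_of_subset hsub).2
        ⟨f, by simp [F, hwf], by simp only [F, Finset.mem_filter]; omega⟩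
      exact (Finset.card_lt_card this).not_ge hcard
    replace hgt : G.dist t g = r + 2 := by simpa [F] using hgt
    replace hgw : G.dist w g ≠ r + 2 := by simpa [F] using hgw
    have h₂ := heccN w hwc g
    have h₃ := hG.dist_le_succ_of_adj hwt.symm g
    have h₄ := hG.dist_le_succ_of_adj hwt f
    have htw := dist_eq_one_iff_adj.2 hwt.symm
    have h₅ := hα f t w g
      (by unfold Itv; rw [dist_comm (u := f) (v := t), dist_comm (u := f) (v := w)]; omega)
      (by unfold Itv; omega) hwt.symm
    have h₆ := hG.dist_triangle (u := f) (v := c) (w := g)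
    have h₇ := hdc f
    have h₈ := hdc g
    rw [dist_comm (u := f) (v := t)] at h₅
    rw [dist_comm (u := f) (v := c)] at h₆
    omega
  obtain ⟨u, hwu, huc⟩ := hG.exists_adj_dist_eq hwc
  have huc' := dist_eq_one_iff_adj.1 huc
  have hcf := hdc f
  have h₁ := hG.dist_le_succ_of_adj huc' f
  have h₂ := hG.dist_le_succ_of_adj hwu f
  have huf : G.dist u f = r + 1 := by omega
  replace hcf : G.dist c f = r := by omega
  have hvw' := dist_eq_one_iff_adj.2 hvw
  have hwu' := dist_eq_one_iff_adj.2 hwu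
  have hvu : G.dist v u = 2 := by
    have h₃ := hG.dist_triangle (u := v) (v := w) (w := u)
    have h₄ := hG.dist_triangle (u := v) (v := u) (w := c)
    omega
  have hvf : G.dist v f = r + 2 := by
    have h₃ := hα v w u f (by unfold Itv; omega) (by unfold Itv; omega) hwu
    have h₄ := dist_le_ecc G v f
    omega
  rcases hα.triangle_or_pentagon hG hvw hvf hwf with
    ⟨t, hvt, hwt, htf⟩ | ⟨a, b, z, hvb, hwa, hbz, haz, haf, hbf, hzf⟩
  · rcases hα.eq_or_adj_of_dist_eq hG hwf hwt hwu htf huf with rfl | htu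
    · have := dist_eq_one_iff_adj.2 hvt
      omega
    · have := hG.dist_le_succ_of_adj htu c
      exact noTriangle t hvt hwt (by omega) htf.le
  have closer : ∀ x m, G.dist v x = 3 → G.dist w x = 2 → G.Adj v m → G.dist m x ≤ 2 →
      G.dist m f ≤ r + 1 → G.Adj w m := by
    intro x m hvx hwx hvm hmx hmf
    have := hG.dist_le_succ_of_adj hvm x
    rcases hα.eq_or_adj_of_dist_eq hG hvx hvw hvm hwx (by omega) with rfl | h
    · omega
    · exact h
  have hbc : 2 < G.dist b c := by
    by_contra! h
    exact noTriangle b hvb (closer c b hvc hwc hvb h hbf.le) h hbf.le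
  have hzc : 1 < G.dist z c := by
    have := hG.dist_le_succ_of_adj hbz c
    omega
  have hau : G.Adj a u := by
    rcases hα.eq_or_adj_of_dist_eq hG hwf hwa hwu haf huf with rfl | h
    · rcases hα.eq_or_adj_of_dist_eq hG haf haz huc' hzf hcf with rfl | h
      · simp at hzc
      · have := dist_eq_one_iff_adj.2 h
        omega
    · exact h
  have h₃ := hG.dist_le_succ_of_adj haz.symm c
  have h₄ := hG.dist_le_succ_of_adj hau c
  have hza := dist_eq_one_iff_adj.2 haz.symm
  have hzc₂ : G.dist z c = 2 := by
    by_contra h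
    have := hα.dist_le_of_itv hG hzf.le hcf.le (z := a) (by unfold Itv; omega)
    omega
  obtain ⟨p, hzp, hpc⟩ := hG.exists_adj_dist_eq hzc₂
  have hzp' := dist_eq_one_iff_adj.2 hzp
  have hpc' := dist_eq_one_iff_adj.1 hpc
  have hpf : G.dist p f ≤ r :=
    hα.dist_le_of_itv hG hzf.le hcf.le (z := p) (by unfold Itv; omega)
  have hbp := hG.dist_le_succ_of_adj hbz p
  have hvp := hG.dist_le_succ_of_adj hvb p
  have hvp' := hG.dist_triangle (u := v) (v := p) (w := f)
  have hvp₃ : G.dist v p = 3 := by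
    by_contra h
    obtain ⟨m, hvm, hmp⟩ := hG.exists_adj_dist_eq (show G.dist v p = 1 + 1 by omega)
    have h₅ := hG.dist_le_succ_of_adj (dist_eq_one_iff_adj.1 hmp) c
    have h₆ := hG.dist_le_succ_of_adj (dist_eq_one_iff_adj.1 hmp) f
    exact noTriangle m hvm (closer c m hvc hwc hvm (by omega) (by omega)) (by omega) (by omega)
  have hwp := hG.dist_le_succ_of_adj hvw p
  have hwp' := hG.dist_triangle (u := w) (v := c) (w := p)
  rw [dist_comm (u := c) (v := p)] at hwp'
  by_cases hwp₂ : G.dist w p = 2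
  · have hwb := closer p b hvp₃ hwp₂ hvb (by omega) hbf.le
    have hbw := dist_eq_one_iff_adj.2 hwb.symm
    rcases hα.eq_or_adj_of_dist_eq hG hwf hwb hwu hbf huf with rfl | hbu
    · omega
    · have := hG.dist_le_succ_of_adj hbu c
      omega
  · have hzw := hG.dist_triangle (u := w) (v := a) (w := z)
    have hwa' := dist_eq_one_iff_adj.2 hwa
    have hwz := hG.dist_triangle (u := w) (v := z) (w := p)
    have haz' := dist_eq_one_iff_adj.2 haz
    have hpw : G.dist p w = 2 + 1 := by rw [dist_comm]; omega
    rcases hα.eq_or_adj_of_dist_eq hG hpw hzp.symm hpc' (by rw [dist_comm]; omega)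
      (by rw [dist_comm]; omega) with rfl | h
    · simp at hzc
    · have := dist_eq_one_iff_adj.2 h
      omega

theorem stmt_16 [Fintype V] [Nonempty V] (G : SimpleGraph V) (hG : G.Connected)
    (hα : AlphaI G 1) (v : V) (hv : ecc G v = grad G + 2) :
    ∃ w : V, G.Adj v w ∧ ecc G w < ecc G v := by
  classical
  obtain ⟨c₀, -, hc₀⟩ := Finset.exists_mem_eq_inf' Finset.univ_nonempty (fun v => ecc G v)
  let C : Finset V := {c | ecc G c = grad G}
  obtain ⟨c, hcC, hmin⟩ := C.exists_min_image (fun c => G.dist v c)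
    ⟨c₀, Finset.mem_filter.2 ⟨Finset.mem_univ c₀, hc₀.symm⟩⟩
  have hc : ecc G c = grad G := by simpa [C] using hcC
  have hge := ecc_le_of_dist hG v c
  obtain ⟨k, hk⟩ : ∃ k, G.dist v c = k + 2 := ⟨G.dist v c - 2, by omega⟩
  -- the vertex preceding `c` on a shortest path from `v` bounds the distance to the center
  obtain ⟨y, hcy, hyv⟩ := hG.exists_adj_dist_eq (x := c) (y := v) (n := k + 1)
    (by rw [SimpleGraph.dist_comm, hk])
  rw [SimpleGraph.dist_comm] at hyv
  have hyc := dist_eq_one_iff_adj.2 hcy.symm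
  have hyecc : grad G < ecc G y := by
    refine lt_of_le_of_ne (Finset.inf'_le _ (Finset.mem_univ y)) fun h => ?_
    have := hmin y (by simp [C, h])
    omega
  obtain ⟨f, hf⟩ := exists_dist_eq_ecc G y
  have h₁ := ecc_le_of_dist hG y c
  have h₂ := dist_le_ecc G c f
  have h₃ := hG.dist_le_succ_of_adj hcy.symm f
  have h₄ := hα v y c f (by unfold Itv; omega) (by unfold Itv; omega) hcy.symm
  have h₅ := dist_le_ecc G v f
  by_cases h₀ : k = 0
  · subst h₀
    exact ⟨y, dist_eq_one_iff_adj.1 hyv, by omega⟩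
  · rw [hv]
    exact hα.exists_adj_ecc_lt hG hv hc.le (by omega)
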